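/- The closure of U equals K₋' ∪ Ū₀ ∪ K₊'. In particular, K ⊆ closure(U). -/

import Mathlib

noncomputable section

open Matrix

abbrev En (n : ℕ) := EuclideanSpace ℝ (Fin n)

/-- The space of symmetric trace-free `n × n` real matrices, as a submodule. -/
def S0 (n : ℕ) : Submodule ℝ (Matrix (Fin n) (Fin n) ℝ) where
  carrier := {σ | σ.IsSymm ∧ σ.trace = 0}
  add_mem' := fun hA hB => ⟨hA.1.add hB.1, by simp [Matrix.trace_add, hA.2, hB.2]⟩
  zero_mem' := ⟨Matrix.isSymm_zero, by simp⟩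
  smul_mem' := fun c A hA => ⟨by rw [Matrix.IsSymm, Matrix.transpose_smul, hA.1], by simp [hA.2]⟩

/-- The state space `Z = ℝ × ℝⁿ × ℝⁿ × S₀ × ℝ`. -/
abbrev Zsp (n : ℕ) := ℝ × En n × En n × ↥(S0 n) × ℝ

/-- Outer product `w ⊗ m`. -/
def op {n : ℕ} (w m : En n) : Matrix (Fin n) (Fin n) ℝ := fun i j => w i * m j

/-- The largest eigenvalue of a (symmetric) matrix, as `sup {ξᵀ A ξ : |ξ| = 1}`. -/
def lamMax {n : ℕ} (A : Matrix (Fin n) (Fin n) ℝ) : ℝ :=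
  sSup {r | ∃ ξ : En n, ‖ξ‖ = 1 ∧ r = ∑ i, ∑ j, ξ i * A i j * ξ j}

/-- The matrix `M(z)`. -/
def Mmat {n : ℕ} (μm μp μ : ℝ) (w m : En n) (σ : Matrix (Fin n) (Fin n) ℝ) :
    Matrix (Fin n) (Fin n) ℝ :=
  (((μp - μ) * (μ - μm))⁻¹) •
      ((μ * μm * μp) • op w w - (μm * μp) • (op m w + op w m) + (μp + μm - μ) • op m m) - σ

/-- `T₊(z)`. -/
def Tp {n : ℕ} (μm μp μ : ℝ) (w m : En n) : ℝ :=
  (μp / (n : ℝ)) * ‖m - μm • w‖ ^ 2 / (μ - μm) ^ 2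

/-- `T₋(z)`. -/
def Tm {n : ℕ} (μm μp μ : ℝ) (w m : En n) : ℝ :=
  (μm / (n : ℝ)) * ‖m - μp • w‖ ^ 2 / (μ - μp) ^ 2

def TpZ {n : ℕ} (μm μp : ℝ) (z : Zsp n) : ℝ := Tp μm μp z.1 z.2.1 z.2.2.1

def TmZ {n : ℕ} (μm μp : ℝ) (z : Zsp n) : ℝ := Tm μm μp z.1 z.2.1 z.2.2.1

def QZ {n : ℕ} (μm μp : ℝ) (z : Zsp n) : ℝ :=
  lamMax (Mmat μm μp z.1 z.2.1 z.2.2.1 (z.2.2.2.1 : Matrix (Fin n) (Fin n) ℝ))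

/-- The open relaxed set `U`. -/
def Uset (n : ℕ) (μm μp e : ℝ) : Set (Zsp n) :=
  {z | z.1 ∈ Set.Ioo μm μp ∧ TpZ μm μp z < e ∧ TmZ μm μp z < e ∧ QZ μm μp z < e}

/-- The constraint set `K`. -/
def Kset (n : ℕ) (μm μp e : ℝ) : Set (Zsp n) :=
  {z | (z.1 = μm ∨ z.1 = μp) ∧ z.2.2.1 = z.1 • z.2.1 ∧
    z.1 • op z.2.1 z.2.1 - (z.2.2.2.1 : Matrix (Fin n) (Fin n) ℝ) =
      e • (1 : Matrix (Fin n) (Fin n) ℝ)}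

/-- The wave cone `Λ`. -/
def Lambda (n : ℕ) : Set (Zsp n) :=
  {z | ¬(z.1 = 0 ∧ z.2.2.1 = 0) ∧
    ∃ (ξ : Fin n → ℝ) (c : ℝ), ¬(ξ = 0 ∧ c = 0) ∧
      ((z.2.2.2.1 : Matrix (Fin n) (Fin n) ℝ) +
          z.2.2.2.2 • (1 : Matrix (Fin n) (Fin n) ℝ)).mulVec ξ + c • (fun i => z.2.2.1 i) = 0 ∧
      (∑ j, z.2.2.1 j * ξ j) + c * z.1 = 0 ∧
      (∑ j, z.2.1 j * ξ j) = 0}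

/-- The projection `π(μ, w, m, σ, q) = (μ, w, m, σ)`. -/
def pz {n : ℕ} (z : Zsp n) : ℝ × En n × En n × ↥(S0 n) := (z.1, z.2.1, z.2.2.1, z.2.2.2.1)

/-- The set `Ū₀`. -/
def U0bar (n : ℕ) (μm μp e : ℝ) : Set (Zsp n) :=
  {z | z.1 ∈ Set.Ioo μm μp ∧ TpZ μm μp z ≤ e ∧ TmZ μm μp z ≤ e ∧ QZ μm μp z ≤ e}

/-- The sets `K₊' = Kprime n μ₊ e` and `K₋' = Kprime n μ₋ e`. -/
def Kprime (n : ℕ) (μ0 e : ℝ) : Set (Zsp n) :=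
  {z | z.1 = μ0 ∧ z.2.2.1 = μ0 • z.2.1 ∧
    lamMax (μ0 • op z.2.1 z.2.1 - (z.2.2.2.1 : Matrix (Fin n) (Fin n) ℝ)) ≤ e}

/-- The quadratic form `ξᵀ A ξ`. -/
def quadForm {n : ℕ} (A : Matrix (Fin n) (Fin n) ℝ) (ξ : En n) : ℝ :=
  ∑ i, ∑ j, ξ i * A i j * ξ j

/-- The Euclidean dot product in coordinates. -/
def dot {n : ℕ} (ξ u : En n) : ℝ := ∑ i, ξ i * u i

section QuadForm

variable {n : ℕ}

lemma quadForm_sub (A B : Matrix (Fin n) (Fin n) ℝ) (ξ : En n) :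
    quadForm (A - B) ξ = quadForm A ξ - quadForm B ξ := by
  simp only [quadForm, Matrix.sub_apply, mul_sub, sub_mul, Finset.sum_sub_distrib]

lemma quadForm_add (A B : Matrix (Fin n) (Fin n) ℝ) (ξ : En n) :
    quadForm (A + B) ξ = quadForm A ξ + quadForm B ξ := by
  simp only [quadForm, Matrix.add_apply, mul_add, add_mul, Finset.sum_add_distrib]

lemma quadForm_smul (c : ℝ) (A : Matrix (Fin n) (Fin n) ℝ) (ξ : En n) :
    quadForm (c • A) ξ = c * quadForm A ξ := by
  simp only [quadForm, Matrix.smul_apply, smul_eq_mul, Finset.mul_sum]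
  refine Finset.sum_congr rfl fun i _ => Finset.sum_congr rfl fun j _ => by ring

lemma quadForm_op (u v ξ : En n) : quadForm (op u v) ξ = dot ξ u * dot ξ v := by
  simp only [quadForm, dot, op, Finset.sum_mul_sum]
  refine Finset.sum_congr rfl fun i _ => Finset.sum_congr rfl fun j _ => by ring

lemma quadForm_single (A : Matrix (Fin n) (Fin n) ℝ) (i : Fin n) :
    quadForm A (EuclideanSpace.single i 1) = A i i := by
  simp [quadForm]

lemma quadForm_one (ξ : En n) : quadForm (1 : Matrix (Fin n) (Fin n) ℝ) ξ = ‖ξ‖ ^ 2 := by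
  rw [EuclideanSpace.real_norm_sq_eq]
  simp [quadForm, Matrix.one_apply, sq]

lemma dot_smul (c : ℝ) (ξ u : En n) : dot ξ (c • u) = c * dot ξ u := by
  simp only [dot, PiLp.smul_apply, smul_eq_mul, Finset.mul_sum]
  refine Finset.sum_congr rfl fun i _ => by ring

lemma quadForm_le_lamMax (A : Matrix (Fin n) (Fin n) ℝ) {ξ : En n} (hξ : ‖ξ‖ = 1) :
    quadForm A ξ ≤ lamMax A := by
  refine le_csSup ⟨∑ i, ∑ j, |A i j|, ?_⟩ ⟨ξ, hξ, rfl⟩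
  rintro _ ⟨η, hη, rfl⟩
  refine Finset.sum_le_sum fun i _ => Finset.sum_le_sum fun j _ => ?_
  have h : ∀ k, |η k| ≤ 1 := fun k => by
    simpa [hη] using PiLp.norm_apply_le η k
  calc η i * A i j * η j ≤ |η i * A i j * η j| := le_abs_self _
    _ = |η i| * |A i j| * |η j| := by rw [abs_mul, abs_mul]
    _ ≤ 1 * |A i j| * 1 := by gcongr <;> exact h _
    _ = |A i j| := by ring

lemma lamMax_le_iff (hn : 0 < n) (A : Matrix (Fin n) (Fin n) ℝ) (c : ℝ) :
    lamMax A ≤ c ↔ ∀ ξ : En n, ‖ξ‖ = 1 → quadForm A ξ ≤ c := by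
  refine ⟨fun h ξ hξ => (quadForm_le_lamMax A hξ).trans h, fun h => ?_⟩
  refine csSup_le ⟨_, EuclideanSpace.single ⟨0, hn⟩ 1, by simp, rfl⟩ ?_
  rintro _ ⟨ξ, hξ, rfl⟩
  exact h ξ hξ

lemma trace_le_of_lamMax_le {A : Matrix (Fin n) (Fin n) ℝ} {c : ℝ} (h : lamMax A ≤ c) :
    A.trace ≤ n * c := by
  calc A.trace = ∑ i, A i i := rfl
    _ ≤ ∑ _i : Fin n, c := Finset.sum_le_sum fun i _ => by
        rw [← quadForm_single A i]
        exact (quadForm_le_lamMax A (by simp)).trans h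
    _ = n * c := by simp

lemma trace_op_self (w : En n) : (op w w).trace = ‖w‖ ^ 2 := by
  rw [EuclideanSpace.real_norm_sq_eq]
  simp [Matrix.trace, op, sq]

lemma quadForm_Mmat (μm μp μ : ℝ) (w m ξ : En n) (σ : Matrix (Fin n) (Fin n) ℝ) :
    quadForm (Mmat μm μp μ w m σ) ξ =
      (μ * μm * μp * dot ξ w ^ 2 - 2 * (μm * μp) * (dot ξ w * dot ξ m) +
        (μp + μm - μ) * dot ξ m ^ 2) / ((μp - μ) * (μ - μm)) - quadForm σ ξ := by
  simp only [Mmat, quadForm_sub, quadForm_add, quadForm_smul, quadForm_op]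
  ring

lemma Mmat_swap (μm μp μ : ℝ) (w m : En n) (σ : Matrix (Fin n) (Fin n) ℝ) :
    Mmat μp μm μ w m σ = Mmat μm μp μ w m σ := by
  rw [Mmat, Mmat, show (μm - μ) * (μ - μp) = (μp - μ) * (μ - μm) by ring,
    show μ * μp * μm = μ * μm * μp by ring, mul_comm μp μm, add_comm μm μp]

end QuadForm

section Closure

variable {n : ℕ} {p q e : ℝ}

/-- The state with density `θ p + (1 - θ) q` obtained by mixing the state `z` of density `p`,
with its velocity scaled by `θ`, and a state of density `q` at rest. -/
def mixRest (p q : ℝ) (z : Zsp n) (θ : ℝ) : Zsp n :=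
  (θ * p + (1 - θ) * q, θ ^ 2 • z.2.1, θ ^ 2 • z.2.2.1, θ ^ 2 • z.2.2.2.1, z.2.2.2.2)

lemma mem_closure_of_forall_Ioo {S : Set (Zsp n)} {f : ℝ → Zsp n} (hf : Continuous f)
    (h : ∀ θ ∈ Set.Ioo (0 : ℝ) 1, f θ ∈ S) : f 1 ∈ closure S := by
  refine mem_closure_of_tendsto (b := nhdsWithin 1 (Set.Iio 1))
    (hf.continuousAt.tendsto.mono_left nhdsWithin_le_nhds) ?_
  filter_upwards [Ioo_mem_nhdsLT (zero_lt_one (α := ℝ))] with θ hθ using h θ hθ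

lemma mixRest_mem (hn : 0 < n) (hp : 0 < p) (hpq : p ≠ q) (he : 0 < e) {z : Zsp n}
    (hz : z ∈ Kprime n p e) {θ : ℝ} (hθ : θ ∈ Set.Ioo (0 : ℝ) 1) :
    TpZ q p (mixRest p q z θ) < e ∧ TmZ q p (mixRest p q z θ) < e ∧
      QZ q p (mixRest p q z θ) < e := by
  obtain ⟨μ, w, m, σ, r⟩ := z
  obtain ⟨hμ, hm, hl⟩ := hz
  obtain ⟨h0, h1⟩ := hθ
  simp only at hμ hm hl
  subst hm
  have hd : p - q ≠ 0 := sub_ne_zero.2 hpq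
  have hn' : (0 : ℝ) < n := by exact_mod_cast hn
  have hθe : θ ^ 2 * e < e :=
    mul_lt_of_lt_one_left he (pow_lt_one₀ h0.le h1 two_ne_zero)
  have htr : p * ‖w‖ ^ 2 ≤ n * e := by
    have := trace_le_of_lamMax_le hl
    rwa [Matrix.trace_sub, Matrix.trace_smul, trace_op_self, σ.2.2, sub_zero, smul_eq_mul] at this
  refine ⟨lt_of_le_of_lt ?_ hθe, ?_, lt_of_le_of_lt ((lamMax_le_iff hn _ _).2 ?_) hθe⟩
  · have h2 : θ ^ 2 • p • w - q • θ ^ 2 • w = (θ ^ 2 * (p - q)) • w := by module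
    have h3 : θ * p + (1 - θ) * q - q = θ * (p - q) := by ring
    simp only [TpZ, Tp, mixRest, h2, h3, norm_smul, mul_pow, Real.norm_eq_abs, sq_abs]
    have h4 : p / n * ((θ ^ 2) ^ 2 * (p - q) ^ 2 * ‖w‖ ^ 2) / (θ ^ 2 * (p - q) ^ 2)
        = θ ^ 2 * (p * ‖w‖ ^ 2 / n) := by field_simp
    rw [h4]
    gcongr
    rwa [div_le_iff₀ hn', mul_comm e]
  · have h2 : θ ^ 2 • p • w - p • θ ^ 2 • w = 0 := by module
    simpa [TmZ, Tm, mixRest, h2] using he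
  · intro ξ hξ
    have hX := (quadForm_le_lamMax _ hξ).trans hl
    rw [quadForm_sub, quadForm_smul, quadForm_op] at hX
    simp only [mixRest, quadForm_Mmat, dot_smul, Submodule.coe_smul, quadForm_smul]
    set X := dot ξ w
    set s := quadForm (σ : Matrix (Fin n) (Fin n) ℝ) ξ
    have h1' : 1 - θ ≠ 0 := by linarith
    have key : ((θ * p + (1 - θ) * q) * q * p * (θ ^ 2 * X) ^ 2 -
        2 * (q * p) * (θ ^ 2 * X * (θ ^ 2 * (p * X))) +
        (p + q - (θ * p + (1 - θ) * q)) * (θ ^ 2 * (p * X)) ^ 2) /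
        ((p - (θ * p + (1 - θ) * q)) * (θ * p + (1 - θ) * q - q)) = θ * (θ ^ 2 * (p * X ^ 2)) := by
      rw [show p - (θ * p + (1 - θ) * q) = (1 - θ) * (p - q) by ring,
        show θ * p + (1 - θ) * q - q = θ * (p - q) by ring]
      field_simp
      ring
    rw [key]
    have h5 : 0 ≤ θ ^ 2 * (p * X ^ 2) := by positivity
    nlinarith [mul_le_mul_of_nonneg_left hX (sq_nonneg θ)]

lemma continuous_mixRest (p q : ℝ) (z : Zsp n) : Continuous (mixRest p q z) := by
  unfold mixRest
  fun_prop

lemma mixRest_one {z : Zsp n} (hz : z ∈ Kprime n p e) : mixRest p q z 1 = z := by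
  obtain ⟨μ, w, m, σ, r⟩ := z
  obtain ⟨hμ, -, -⟩ := hz
  simp only at hμ
  simp [mixRest, hμ]

end Closure

section Main

variable {n : ℕ} {μm μp e : ℝ}

lemma Kprime_plus_subset (hn : 0 < n) (hμm : 0 < μm) (hμ : μm < μp) (he : 0 < e) :
    Kprime n μp e ⊆ closure (Uset n μm μp e) := by
  intro z hz
  rw [← mixRest_one (q := μm) hz]
  refine mem_closure_of_forall_Ioo (continuous_mixRest _ _ z) fun θ hθ => ?_
  refine ⟨⟨?_, ?_⟩, mixRest_mem hn (hμm.trans hμ) hμ.ne' he hz hθ⟩ <;>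
    simp only [mixRest] <;> nlinarith [hθ.1, hθ.2]

lemma Kprime_minus_subset (hn : 0 < n) (hμm : 0 < μm) (hμ : μm < μp) (he : 0 < e) :
    Kprime n μm e ⊆ closure (Uset n μm μp e) := by
  intro z hz
  rw [← mixRest_one (q := μp) hz]
  refine mem_closure_of_forall_Ioo (continuous_mixRest _ _ z) fun θ hθ => ?_
  obtain ⟨h1, h2, h3⟩ := mixRest_mem hn hμm hμ.ne he hz hθ
  rw [QZ, Mmat_swap] at h3
  refine ⟨⟨?_, ?_⟩, h2, h1, h3⟩ <;> simp only [mixRest] <;> nlinarith [hθ.1, hθ.2]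

lemma U0bar_subset (hn : 0 < n) (he : 0 < e) :
    U0bar n μm μp e ⊆ closure (Uset n μm μp e) := by
  rintro ⟨μ, w, m, σ, r⟩ ⟨hμ, h1, h2, h3⟩
  let f : ℝ → Zsp n := fun t => (μ, t • w, t • m, t ^ 2 • σ, r)
  have hf : Continuous f := by fun_prop
  rw [show (μ, w, m, σ, r) = f 1 by simp [f]]
  refine mem_closure_of_forall_Ioo hf fun t ht => ?_
  have hte : t ^ 2 * e < e :=
    mul_lt_of_lt_one_left he (pow_lt_one₀ ht.1.le ht.2 two_ne_zero)
  have hn' (c : ℝ) : ‖t • m - c • t • w‖ ^ 2 = t ^ 2 * ‖m - c • w‖ ^ 2 := by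
    rw [show t • m - c • t • w = t • (m - c • w) by module, norm_smul, mul_pow,
      Real.norm_eq_abs, sq_abs]
  refine ⟨hμ, lt_of_le_of_lt ?_ hte, lt_of_le_of_lt ?_ hte,
    lt_of_le_of_lt ((lamMax_le_iff hn _ _).2 fun ξ hξ => ?_) hte⟩
  · calc TpZ μm μp (f t) = t ^ 2 * TpZ μm μp (μ, w, m, σ, r) := by
          simp only [TpZ, Tp, f, hn']; ring
      _ ≤ _ := by gcongr
  · calc TmZ μm μp (f t) = t ^ 2 * TmZ μm μp (μ, w, m, σ, r) := by
          simp only [TmZ, Tm, f, hn']; ring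
      _ ≤ _ := by gcongr
  · have h := (quadForm_le_lamMax _ hξ).trans h3
    refine le_trans (le_of_eq ?_) (mul_le_mul_of_nonneg_left h (sq_nonneg t))
    simp only [f, quadForm_Mmat, dot_smul, Submodule.coe_smul, quadForm_smul]
    ring

/-- A set cut out by polynomial inequalities, valid on `Uset` and stable under limits. -/
def polyHull (n : ℕ) (μm μp e : ℝ) : Set (Zsp n) :=
  {z | μm ≤ z.1 ∧ z.1 ≤ μp ∧
    μp * ‖z.2.2.1 - μm • z.2.1‖ ^ 2 ≤ n * e * (z.1 - μm) ^ 2 ∧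
    μm * ‖z.2.2.1 - μp • z.2.1‖ ^ 2 ≤ n * e * (z.1 - μp) ^ 2 ∧
    ∀ ξ : En n, ‖ξ‖ = 1 →
      z.1 * μm * μp * dot ξ z.2.1 ^ 2 - 2 * (μm * μp) * (dot ξ z.2.1 * dot ξ z.2.2.1) +
          (μp + μm - z.1) * dot ξ z.2.2.1 ^ 2 ≤
        (e + quadForm z.2.2.2.1 ξ) * ((μp - z.1) * (z.1 - μm)) ∧
      μp * (dot ξ z.2.2.1 - μm * dot ξ z.2.1) ^ 2 ≤
        (μp - μm) * (z.1 - μm) * (e + quadForm z.2.2.2.1 ξ) ∧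
      μm * (dot ξ z.2.2.1 - μp * dot ξ z.2.1) ^ 2 ≤
        (μp - μm) * (μp - z.1) * (e + quadForm z.2.2.2.1 ξ)}

lemma isClosed_polyHull : IsClosed (polyHull n μm μp e) := by
  have hS (ξ : En n) : Continuous fun z : Zsp n =>
      quadForm (z.2.2.2.1 : Matrix (Fin n) (Fin n) ℝ) ξ := by
    refine continuous_finsetSum _ fun i _ => continuous_finsetSum _ fun j _ => ?_
    have h : Continuous fun z : Zsp n => (z.2.2.2.1 : Matrix (Fin n) (Fin n) ℝ) := by fun_prop
    exact (continuous_const.mul (h.matrix_elem i j)).mul continuous_const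
  have hw (ξ : En n) : Continuous fun z : Zsp n => dot ξ z.2.1 := by
    unfold dot
    fun_prop
  have hm (ξ : En n) : Continuous fun z : Zsp n => dot ξ z.2.2.1 := by
    unfold dot
    fun_prop
  simp only [polyHull, Set.ofPred_and, Set.ofPred_forall]
  refine (isClosed_le (by fun_prop) (by fun_prop)).inter <|
    (isClosed_le (by fun_prop) (by fun_prop)).inter <|
    (isClosed_le (by fun_prop) (by fun_prop)).inter <|
    (isClosed_le (by fun_prop) (by fun_prop)).inter <|
    isClosed_iInter fun ξ => isClosed_iInter fun _ => ?_
  have := hS ξ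
  have := hw ξ
  have := hm ξ
  exact (isClosed_le (by fun_prop) (by fun_prop)).inter <|
    (isClosed_le (by fun_prop) (by fun_prop)).inter (isClosed_le (by fun_prop) (by fun_prop))

lemma Tp_le_iff (hn : 0 < n) {μ : ℝ} (h : μ ≠ μm) (w m : En n) :
    Tp μm μp μ w m ≤ e ↔ μp * ‖m - μm • w‖ ^ 2 ≤ n * e * (μ - μm) ^ 2 := by
  have hn' : (0 : ℝ) < n := by exact_mod_cast hn
  have h' : 0 < (μ - μm) ^ 2 := by have := sub_ne_zero.2 h; positivity
  rw [Tp, div_le_iff₀ h', div_mul_eq_mul_div, div_le_iff₀ hn']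
  ring_nf

lemma Uset_subset_polyHull (hn : 0 < n) (hμm : 0 < μm) :
    Uset n μm μp e ⊆ polyHull n μm μp e := by
  rintro ⟨μ, w, m, σ, r⟩ ⟨⟨hl, hr⟩, h1, h2, h3⟩
  simp only at hl hr
  refine ⟨hl.le, hr.le, (Tp_le_iff hn hl.ne' w m).1 h1.le, (Tp_le_iff hn hr.ne w m).1 h2.le,
    fun ξ hξ => ?_⟩
  have h := (quadForm_le_lamMax _ hξ).trans h3.le
  have ha : 0 < μp - μ := sub_pos.2 hr
  have hb : 0 < μ - μm := sub_pos.2 hl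
  simp only [quadForm_Mmat] at h ⊢
  rw [sub_le_iff_le_add, div_le_iff₀ (mul_pos ha hb)] at h
  generalize dot ξ w = x at *
  generalize dot ξ m = y at *
  generalize quadForm (σ : Matrix (Fin n) (Fin n) ℝ) ξ = s at *
  have hμp : 0 < μp := by linarith
  have hd : 0 < μp - μm := by linarith
  -- the numerator of `M` is a positive combination of the two squares
  have hid : μp * (μp - μ) * (y - μm * x) ^ 2 + μm * (μ - μm) * (y - μp * x) ^ 2 =
      (μp - μm) * (μ * μm * μp * x ^ 2 - 2 * (μm * μp) * (x * y) + (μp + μm - μ) * y ^ 2) := by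
    ring
  have h' := mul_le_mul_of_nonneg_left h hd.le
  have hA : 0 ≤ μp * (μp - μ) * (y - μm * x) ^ 2 := by positivity
  have hB : 0 ≤ μm * (μ - μm) * (y - μp * x) ^ 2 := by positivity
  refine ⟨h, le_of_mul_le_mul_left ?_ ha, le_of_mul_le_mul_left ?_ hb⟩
  · linarith
  · linarith

lemma polyHull_subset (hn : 0 < n) (hμm : 0 < μm) (hμ : μm < μp) :
    polyHull n μm μp e ⊆ Kprime n μm e ∪ U0bar n μm μp e ∪ Kprime n μp e := by
  rintro ⟨μ, w, m, σ, r⟩ ⟨hl, hr, h1, h2, h3⟩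
  simp only at hl hr h1 h2 h3
  have hd : 0 < (μp - μm) ^ 2 := by have := sub_pos.2 hμ; positivity
  rcases hl.eq_or_lt with rfl | hl
  · left; left
    have hm : m = μm • w := by
      rw [sub_self] at h1
      have h0 : ‖m - μm • w‖ ^ 2 ≤ 0 := by nlinarith
      simpa [sub_eq_zero] using le_antisymm h0 (sq_nonneg _)
    refine ⟨rfl, hm, (lamMax_le_iff hn _ _).2 fun ξ hξ => ?_⟩
    have h := (h3 ξ hξ).2.2
    simp only [hm, dot_smul, quadForm_sub, quadForm_smul, quadForm_op] at h ⊢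
    refine le_of_mul_le_mul_left ?_ hd
    linarith
  rcases hr.eq_or_lt with rfl | hr
  · right
    have hm : m = μ • w := by
      rw [sub_self] at h2
      have h0 : ‖m - μ • w‖ ^ 2 ≤ 0 := by nlinarith
      simpa [sub_eq_zero] using le_antisymm h0 (sq_nonneg _)
    refine ⟨rfl, hm, (lamMax_le_iff hn _ _).2 fun ξ hξ => ?_⟩
    have h := (h3 ξ hξ).2.1
    simp only [hm, dot_smul, quadForm_sub, quadForm_smul, quadForm_op] at h ⊢
    refine le_of_mul_le_mul_left ?_ hd
    linarith
  · left; right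
    refine ⟨⟨hl, hr⟩, (Tp_le_iff hn hl.ne' w m).2 h1, (Tp_le_iff hn hr.ne w m).2 h2,
      (lamMax_le_iff hn _ _).2 fun ξ hξ => ?_⟩
    rw [quadForm_Mmat, sub_le_iff_le_add,
      div_le_iff₀ (mul_pos (sub_pos.2 hr) (sub_pos.2 hl))]
    exact (h3 ξ hξ).1

lemma Kset_subset (hn : 0 < n) : Kset n μm μp e ⊆ Kprime n μm e ∪ Kprime n μp e := by
  rintro ⟨μ, w, m, σ, r⟩ ⟨h1, h2, h3⟩
  simp only at h1 h2 h3
  have hle : lamMax (μ • op w w - (σ : Matrix (Fin n) (Fin n) ℝ)) ≤ e := by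
    rw [h3, lamMax_le_iff hn]
    intro ξ hξ
    simp [quadForm_smul, quadForm_one, hξ]
  rcases h1 with rfl | rfl
  · exact Or.inl ⟨rfl, h2, hle⟩
  · exact Or.inr ⟨rfl, h2, hle⟩

end Main

/-- `closure U = K₋' ∪ Ū₀ ∪ K₊'`; in particular `K ⊆ closure U`. -/
theorem closure_U_eq (n : ℕ) (hn : 2 ≤ n) (μm μp : ℝ) (hμm : 0 < μm) (hμ : μm < μp)
    (e : ℝ) (he : 0 < e) :
    closure (Uset n μm μp e) = Kprime n μm e ∪ U0bar n μm μp e ∪ Kprime n μp e ∧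
      Kset n μm μp e ⊆ closure (Uset n μm μp e) := by
  have hn0 : 0 < n := by omega
  have hm := Kprime_minus_subset hn0 hμm hμ he
  have hp := Kprime_plus_subset hn0 hμm hμ he
  refine ⟨Set.Subset.antisymm ?_ ?_, (Kset_subset hn0).trans (Set.union_subset hm hp)⟩
  · exact (closure_minimal (Uset_subset_polyHull hn0 hμm) isClosed_polyHull).trans
      (polyHull_subset hn0 hμm hμ)
  · exact Set.union_subset (Set.union_subset hm (U0bar_subset hn0 he)) hp
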